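/- (Theorem 4.1, one-sided truncations) Suppose A is block-tridiagonal, i.e. A equals its tridiagonal part B (so C = 0), and write A^+_{n,k} := B^+_{n,k}. Then, for every n ∈ {1, …, N−1}: min_{0≤k≤N−n} ν(A^+_{n,k}) ≤ ν(A) + ε''_n(A) ≤ min_{0≤k≤N−n} ν(A^+_{n,k}) + ε''_n(A). -/

import Mathlib

open scoped Real

noncomputable section

namespace SpecIncl

/-- The smallest singular value of a (possibly rectangular) complex matrix,
as the infimum of `‖F x‖` over the unit sphere. -/
noncomputable def sval {ι κ : Type*} [Fintype ι] [Fintype κ] [DecidableEq κ]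
    (F : Matrix ι κ ℂ) : ℝ :=
  sInf {y : ℝ | ∃ x : EuclideanSpace ℂ κ, ‖x‖ = 1 ∧ y = ‖Matrix.toEuclideanLin F x‖}

/-- The spectral norm (2-norm) of a complex matrix. -/
noncomputable def opNorm {ι κ : Type*} [Fintype ι] [Fintype κ] [DecidableEq κ]
    (F : Matrix ι κ ℂ) : ℝ :=
  sSup {y : ℝ | ∃ x : EuclideanSpace ℂ κ, ‖x‖ = 1 ∧ y = ‖Matrix.toEuclideanLin F x‖}

/-- The closed ε-pseudospectrum of a square complex matrix. -/
noncomputable def pspec {ι : Type*} [Fintype ι] [DecidableEq ι] (ε : ℝ)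
    (E : Matrix ι ι ℂ) : Set ℂ :=
  {z : ℂ | sval (E - z • (1 : Matrix ι ι ℂ)) ≤ ε}

/-- Assemble blocks into a block matrix indexed by a sigma type. -/
def blockMat {N : ℕ} (m : Fin N → ℕ)
    (a : ∀ i j : Fin N, Matrix (Fin (m i)) (Fin (m j)) ℂ) :
    Matrix ((i : Fin N) × Fin (m i)) ((j : Fin N) × Fin (m j)) ℂ :=
  fun p q => a p.1 q.1 p.2 q.2

/-- The block-tridiagonal part of a block matrix. -/
def triPart {N : ℕ} {m : Fin N → ℕ}
    (a : ∀ i j : Fin N, Matrix (Fin (m i)) (Fin (m j)) ℂ) :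
    ∀ i j : Fin N, Matrix (Fin (m i)) (Fin (m j)) ℂ :=
  fun i j => if |(i : ℤ) - (j : ℤ)| ≤ 1 then a i j else 0

/-- The remaining (off-tridiagonal) part of a block matrix. -/
def remPart {N : ℕ} {m : Fin N → ℕ}
    (a : ∀ i j : Fin N, Matrix (Fin (m i)) (Fin (m j)) ℂ) :
    ∀ i j : Fin N, Matrix (Fin (m i)) (Fin (m j)) ℂ :=
  fun i j => if |(i : ℤ) - (j : ℤ)| ≤ 1 then 0 else a i j

/-- r_L(A): max of the norms of the first-subdiagonal blocks. -/
noncomputable def rL {N : ℕ} {m : Fin N → ℕ}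
    (a : ∀ i j : Fin N, Matrix (Fin (m i)) (Fin (m j)) ℂ) : ℝ :=
  sSup {y : ℝ | ∃ i j : Fin N, (j : ℕ) + 1 = (i : ℕ) ∧ y = opNorm (a i j)}

/-- r_U(A): max of the norms of the first-superdiagonal blocks. -/
noncomputable def rU {N : ℕ} {m : Fin N → ℕ}
    (a : ∀ i j : Fin N, Matrix (Fin (m i)) (Fin (m j)) ℂ) : ℝ :=
  sSup {y : ℝ | ∃ i j : Fin N, (i : ℕ) + 1 = (j : ℕ) ∧ y = opNorm (a i j)}

noncomputable def rA {N : ℕ} {m : Fin N → ℕ}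
    (a : ∀ i j : Fin N, Matrix (Fin (m i)) (Fin (m j)) ℂ) : ℝ :=
  rL a + rU a

/-- θ_n for the coefficient `c = r_L r_U / r²`: the unique solution of
`2 sin(t/2) cos((n+1/2)t) + c sin((n−1)t) = 0` in `[π/(2n+1), π/(n+2)]`
(by uniqueness, equal to the infimum of the solution set). -/
noncomputable def theta (c : ℝ) (n : ℕ) : ℝ :=
  sInf {t : ℝ | t ∈ Set.Icc (Real.pi / (2 * (n : ℝ) + 1)) (Real.pi / ((n : ℝ) + 2)) ∧
    2 * Real.sin (t / 2) * Real.cos (((n : ℝ) + 1 / 2) * t)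
      + c * Real.sin (((n : ℝ) - 1) * t) = 0}

/-- ε_n(A) := 2 r(A) sin(θ_n(A)/2) + ‖C‖. -/
noncomputable def epsTau {N : ℕ} {m : Fin N → ℕ}
    (a : ∀ i j : Fin N, Matrix (Fin (m i)) (Fin (m j)) ℂ) (n : ℕ) : ℝ :=
  2 * rA a * Real.sin (theta (rL a * rU a / (rA a) ^ 2) n / 2)
    + opNorm (blockMat m (remPart a))

/-- The index `k + i` in `Fin N` (0-based window of length `n` starting at `k`). -/
def widx {N n k : ℕ} (h : k + n ≤ N) (i : Fin n) : Fin N :=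
  ⟨k + i, by have := i.isLt; omega⟩

/-- The principal submatrix `B_{n,k}` of a block matrix, with block rows and
columns `k+1,…,k+n` (1-based), i.e. `k,…,k+n-1` (0-based). -/
def window {N : ℕ} {m : Fin N → ℕ}
    (b : ∀ i j : Fin N, Matrix (Fin (m i)) (Fin (m j)) ℂ)
    (n k : ℕ) (h : k + n ≤ N) :
    Matrix ((i : Fin n) × Fin (m (widx h i))) ((j : Fin n) × Fin (m (widx h j))) ℂ :=
  fun p q => b (widx h p.1) (widx h q.1) p.2 q.2

/-- σ^n_ε(A) of the τ-method. -/
noncomputable def sigmaLow {N : ℕ} {m : Fin N → ℕ}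
    (a : ∀ i j : Fin N, Matrix (Fin (m i)) (Fin (m j)) ℂ)
    (n : ℕ) (h : n ≤ N) (ε : ℝ) : Set ℂ :=
  (⋃ k : Fin (N - n + 1),
      pspec (ε + epsTau a n)
        (window (triPart a) n k (by have := k.isLt; omega))) ∪
  (⋃ m' : Fin (n - 1),
      pspec (ε + epsTau a n)
        (window (triPart a) (m' + 1) 0 (by have := m'.isLt; omega)) ∪
      pspec (ε + epsTau a n)
        (window (triPart a) (m' + 1) (N - (m' + 1)) (by have := m'.isLt; omega)))

/-- σ̂^n_ε(A) of the τ-method. -/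
noncomputable def sigmaHat {N : ℕ} {m : Fin N → ℕ}
    (a : ∀ i j : Fin N, Matrix (Fin (m i)) (Fin (m j)) ℂ)
    (n : ℕ) (h : n ≤ N) (ε : ℝ) : Set ℂ :=
  ⋃ k : Fin (N - n + 1),
    pspec (ε + epsTau a (n - 2))
      (window (triPart a) n k (by have := k.isLt; omega))

/-- The τ-method inclusion set Σ^n_ε(A). -/
noncomputable def SigmaTau {N : ℕ} {m : Fin N → ℕ}
    (a : ∀ i j : Fin N, Matrix (Fin (m i)) (Fin (m j)) ℂ)
    (n : ℕ) (h : n ≤ N) (ε : ℝ) : Set ℂ :=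
  if n ≤ 2 then sigmaLow a n h ε else sigmaLow a n h ε ∩ sigmaHat a n h ε


/-- The row size of the extended block structure: `m i` for `0 ≤ i < N`
(0-based), and `1` (the paper's `1 × m` zero-block convention) otherwise. -/
def rsz {N : ℕ} (m : Fin N → ℕ) (i : ℤ) : ℕ :=
  if h : 0 ≤ i ∧ i < N then m ⟨i.toNat, by omega⟩ else 1

/-- Scalar access to a block matrix extended by zeros outside the index
range `{0,…,N−1}` (0-based). -/
noncomputable def sb {N : ℕ} {m : Fin N → ℕ}
    (b : ∀ i j : Fin N, Matrix (Fin (m i)) (Fin (m j)) ℂ)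
    (i j : ℤ) (α β : ℕ) : ℂ :=
  if hi : 0 ≤ i ∧ i < N then
    if hj : 0 ≤ j ∧ j < N then
      if hα : α < m ⟨i.toNat, by omega⟩ then
        if hβ : β < m ⟨j.toNat, by omega⟩ then
          b ⟨i.toNat, by omega⟩ ⟨j.toNat, by omega⟩ ⟨α, hα⟩ ⟨β, hβ⟩
        else 0
      else 0
    else 0
  else 0

/-- The rectangular one-sided truncation `B^+_{n,k}`: the `(n+2) × n` block
matrix with first block row `(b_{k,k+1}, 0, …, 0)`, middle part `B_{n,k}`, and
last block row `(0, …, 0, b_{k+n+1,k+n})` (1-based indices as in the paper). -/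
noncomputable def Bplus {N : ℕ} {m : Fin N → ℕ}
    (b : ∀ i j : Fin N, Matrix (Fin (m i)) (Fin (m j)) ℂ)
    (n k : ℕ) (h : k + n ≤ N) :
    Matrix ((i : Fin (n + 2)) × Fin (rsz m ((k : ℤ) - 1 + i)))
      ((j : Fin n) × Fin (m (widx h j))) ℂ :=
  fun p q => sb b ((k : ℤ) - 1 + p.1) ((k : ℤ) + q.1) p.2 q.2

/-- The rectangular matrix `I⁺_n` whose middle `n × n` block part is the
identity and whose first and last block rows are zero. -/
noncomputable def IplusMat {N : ℕ} (m : Fin N → ℕ)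
    (n k : ℕ) (h : k + n ≤ N) :
    Matrix ((i : Fin (n + 2)) × Fin (rsz m ((k : ℤ) - 1 + i)))
      ((j : Fin n) × Fin (m (widx h j))) ℂ :=
  fun p q => if (p.1 : ℕ) = (q.1 : ℕ) + 1 ∧ (p.2 : ℕ) = (q.2 : ℕ) then 1 else 0

/-- ε''_n(A) := 2 r(A) sin(π/(2n+2)) + ‖C‖. -/
noncomputable def epsTau1 {N : ℕ} {m : Fin N → ℕ}
    (a : ∀ i j : Fin N, Matrix (Fin (m i)) (Fin (m j)) ℂ) (n : ℕ) : ℝ :=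
  2 * rA a * Real.sin (Real.pi / (2 * (n : ℝ) + 2))
    + opNorm (blockMat m (remPart a))

/-- The τ₁-method inclusion set Γ^n_ε(A): the union over `k` of the closed
`(ε+ε''_n(A))`-pseudospectra of the rectangular matrices `B^+_{n,k}`. -/
lemma kwin {N n : ℕ} (h : n ≤ N) (k : Fin (N - n + 1)) : (k : ℕ) + n ≤ N := by
  have := k.isLt; omega

noncomputable def GammaTau1 {N : ℕ} {m : Fin N → ℕ}
    (a : ∀ i j : Fin N, Matrix (Fin (m i)) (Fin (m j)) ℂ)
    (n : ℕ) (h : n ≤ N) (ε : ℝ) : Set ℂ :=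
  ⋃ k : Fin (N - n + 1),
    {z : ℂ | sval (Bplus (triPart a) n k (kwin h k)
        - z • IplusMat m n k (kwin h k)) ≤ ε + epsTau1 a n}

end SpecIncl

namespace SpecIncl

section SingularValues

variable {ι κ : Type*} [Fintype κ]

lemma norm_smul_inv_self {x : EuclideanSpace ℂ κ} (hx : x ≠ 0) :
    ‖((‖x‖⁻¹ : ℝ) : ℂ) • x‖ = 1 := by
  rw [norm_smul]
  simp [hx]

variable [DecidableEq κ]

lemma toEuclideanLin_apply_eq_sum (F : Matrix ι κ ℂ) (x : EuclideanSpace ℂ κ) (p : ι) :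
    Matrix.toEuclideanLin F x p = ∑ q, F p q * x q := by
  simp [Matrix.toLpLin_apply, Matrix.mulVec, dotProduct]

variable [Fintype ι]

lemma norm_sq_toEuclideanLin (F : Matrix ι κ ℂ) (x : EuclideanSpace ℂ κ) :
    ‖Matrix.toEuclideanLin F x‖ ^ 2 = ∑ p, ‖∑ q, F p q * x q‖ ^ 2 := by
  simp only [EuclideanSpace.norm_sq_eq, toEuclideanLin_apply_eq_sum]

lemma norm_toEuclideanLin_smul_inv (F : Matrix ι κ ℂ) (x : EuclideanSpace ℂ κ) :
    ‖Matrix.toEuclideanLin F (((‖x‖⁻¹ : ℝ) : ℂ) • x)‖ = ‖x‖⁻¹ * ‖Matrix.toEuclideanLin F x‖ := by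
  rw [map_smul, norm_smul]
  simp

lemma sval_nonneg (F : Matrix ι κ ℂ) : 0 ≤ sval F := by
  apply Real.sInf_nonneg
  rintro y ⟨x, -, rfl⟩
  exact norm_nonneg _

lemma sval_le_norm (F : Matrix ι κ ℂ) {x : EuclideanSpace ℂ κ} (hx : ‖x‖ = 1) :
    sval F ≤ ‖Matrix.toEuclideanLin F x‖ := by
  refine csInf_le ⟨0, ?_⟩ ⟨x, hx, rfl⟩
  rintro y ⟨x, -, rfl⟩
  exact norm_nonneg _

lemma sval_mul_norm_le (F : Matrix ι κ ℂ) (x : EuclideanSpace ℂ κ) :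
    sval F * ‖x‖ ≤ ‖Matrix.toEuclideanLin F x‖ := by
  rcases eq_or_ne x 0 with rfl | hx
  · simp
  · have h := sval_le_norm F (norm_smul_inv_self hx)
    rw [norm_toEuclideanLin_smul_inv, inv_mul_eq_div] at h
    exact (le_div_iff₀ (norm_pos_iff.mpr hx)).mp h

lemma le_sval [Nonempty κ] {F : Matrix ι κ ℂ} {c : ℝ}
    (h : ∀ x : EuclideanSpace ℂ κ, ‖x‖ = 1 → c ≤ ‖Matrix.toEuclideanLin F x‖) :
    c ≤ sval F := by
  obtain ⟨x, hx⟩ := exists_norm_eq (EuclideanSpace ℂ κ) (zero_le_one' ℝ)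
  refine le_csInf ⟨_, x, hx, rfl⟩ ?_
  rintro y ⟨x, hx, rfl⟩
  exact h x hx

lemma opNorm_nonneg (F : Matrix ι κ ℂ) : 0 ≤ opNorm F := by
  apply Real.sSup_nonneg
  rintro y ⟨x, -, rfl⟩
  exact norm_nonneg _

lemma norm_le_opNorm_mul (F : Matrix ι κ ℂ) (x : EuclideanSpace ℂ κ) :
    ‖Matrix.toEuclideanLin F x‖ ≤ opNorm F * ‖x‖ := by
  rcases eq_or_ne x 0 with rfl | hx
  · simp
  · have h : ‖Matrix.toEuclideanLin F (((‖x‖⁻¹ : ℝ) : ℂ) • x)‖ ≤ opNorm F := by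
      refine le_csSup ⟨‖(Matrix.toEuclideanLin F).toContinuousLinearMap‖, ?_⟩
        ⟨_, norm_smul_inv_self hx, rfl⟩
      rintro y ⟨z, hz, rfl⟩
      simpa [hz] using (Matrix.toEuclideanLin F).toContinuousLinearMap.le_opNorm z
    rw [norm_toEuclideanLin_smul_inv, inv_mul_eq_div] at h
    exact (div_le_iff₀ (norm_pos_iff.mpr hx)).mp h

end SingularValues

section Blocks

variable {N : ℕ} {m : Fin N → ℕ} (a : ∀ i j : Fin N, Matrix (Fin (m i)) (Fin (m j)) ℂ)

lemma bddAbove_opNorm_blocks (ρ : Fin N → Fin N → Prop) :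
    BddAbove {y : ℝ | ∃ i j : Fin N, ρ i j ∧ y = opNorm (a i j)} := by
  refine ((Set.finite_range fun p : Fin N × Fin N => opNorm (a p.1 p.2)).subset ?_).bddAbove
  rintro y ⟨i, j, -, rfl⟩
  exact ⟨(i, j), rfl⟩

lemma opNorm_le_rL {i j : Fin N} (h : (j : ℕ) + 1 = i) : opNorm (a i j) ≤ rL a :=
  le_csSup (bddAbove_opNorm_blocks a fun i j => (j : ℕ) + 1 = i) ⟨i, j, h, rfl⟩

lemma opNorm_le_rU {i j : Fin N} (h : (i : ℕ) + 1 = j) : opNorm (a i j) ≤ rU a :=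
  le_csSup (bddAbove_opNorm_blocks a fun i j => (i : ℕ) + 1 = j) ⟨i, j, h, rfl⟩

lemma rL_nonneg : 0 ≤ rL a := by
  apply Real.sSup_nonneg
  rintro y ⟨i, j, -, rfl⟩
  exact opNorm_nonneg _

lemma rU_nonneg : 0 ≤ rU a := by
  apply Real.sSup_nonneg
  rintro y ⟨i, j, -, rfl⟩
  exact opNorm_nonneg _

/-- The blocks of `a` at the positions selected by `ρ`, all others replaced by zero. -/
def selectBlocks (ρ : Fin N → Fin N → Prop) [DecidableRel ρ] :
    ∀ i j : Fin N, Matrix (Fin (m i)) (Fin (m j)) ℂ :=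
  fun i j => if ρ i j then a i j else 0

/-- A block matrix with at most one nonzero block in every block row and block column is
bounded by the largest norm of its blocks. -/
lemma norm_selectBlocks_le (ρ : Fin N → Fin N → Prop) [DecidableRel ρ]
    (hrow : ∀ i j j', ρ i j → ρ i j' → j = j') (hcol : ∀ i i' j, ρ i j → ρ i' j → i = i')
    {r : ℝ} (hr : 0 ≤ r) (h : ∀ i j, ρ i j → opNorm (a i j) ≤ r)
    (x : EuclideanSpace ℂ ((i : Fin N) × Fin (m i))) :
    ‖Matrix.toEuclideanLin (blockMat m (selectBlocks a ρ)) x‖ ≤ r * ‖x‖ := by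
  have hblock : ∀ i j, ρ i j →
      ∑ α, ‖∑ β, a i j α β * x ⟨j, β⟩‖ ^ 2 ≤ r ^ 2 * ∑ β, ‖x ⟨j, β⟩‖ ^ 2 := by
    intro i j hij
    have h1 := (norm_le_opNorm_mul (a i j) (WithLp.toLp 2 fun β => x ⟨j, β⟩)).trans
      (mul_le_mul_of_nonneg_right (h i j hij) (norm_nonneg _))
    have h2 := pow_le_pow_left₀ (norm_nonneg _) h1 2
    rwa [mul_pow, norm_sq_toEuclideanLin, EuclideanSpace.norm_sq_eq] at h2
  have hsel : ∀ i j α, ∑ β, selectBlocks a ρ i j α β * x ⟨j, β⟩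
      = if ρ i j then ∑ β, a i j α β * x ⟨j, β⟩ else 0 := by
    intro i j α
    unfold selectBlocks
    split_ifs <;> simp
  have hrowsum : ∀ i, ∑ α, ‖∑ j, ∑ β, selectBlocks a ρ i j α β * x ⟨j, β⟩‖ ^ 2
      ≤ ∑ j, if ρ i j then r ^ 2 * ∑ β, ‖x ⟨j, β⟩‖ ^ 2 else 0 := by
    intro i
    simp only [hsel]
    by_cases hi : ∃ j, ρ i j
    · obtain ⟨j, hj⟩ := hi
      have hiff : ∀ j', ρ i j' ↔ j = j' := fun j' => ⟨hrow i j j' hj, fun e => e ▸ hj⟩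
      simpa only [hiff, Finset.sum_ite_eq, Finset.mem_univ, if_true] using hblock i j hj
    · push Not at hi
      simp [hi]
  refine le_of_sq_le_sq ?_ (by positivity)
  rw [norm_sq_toEuclideanLin, mul_pow, EuclideanSpace.norm_sq_eq]
  simp only [Fintype.sum_sigma]
  calc _ ≤ ∑ i, ∑ j, if ρ i j then r ^ 2 * ∑ β, ‖x ⟨j, β⟩‖ ^ 2 else 0 :=
        Finset.sum_le_sum fun i _ => hrowsum i
    _ = ∑ j, ∑ i, if ρ i j then r ^ 2 * ∑ β, ‖x ⟨j, β⟩‖ ^ 2 else 0 := Finset.sum_comm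
    _ ≤ ∑ j, r ^ 2 * ∑ β, ‖x ⟨j, β⟩‖ ^ 2 := by
        refine Finset.sum_le_sum fun j _ => ?_
        by_cases hj : ∃ i, ρ i j
        · obtain ⟨i, hi⟩ := hj
          have hiff : ∀ i', ρ i' j ↔ i = i' := fun i' => ⟨hcol i i' j hi, fun e => e ▸ hi⟩
          simp [hiff]
        · push Not at hj
          simp only [hj, if_false, Finset.sum_const_zero]
          positivity
    _ = _ := by rw [Finset.mul_sum]

lemma norm_lower_le (x : EuclideanSpace ℂ ((i : Fin N) × Fin (m i))) :
    ‖Matrix.toEuclideanLin (blockMat m (selectBlocks a fun i j => (j : ℕ) + 1 = i)) x‖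
      ≤ rL a * ‖x‖ :=
  norm_selectBlocks_le a _ (fun i j j' h h' => Fin.ext (by omega))
    (fun i i' j h h' => Fin.ext (by omega)) (rL_nonneg a) (fun _ _ => opNorm_le_rL a) x

lemma norm_upper_le (x : EuclideanSpace ℂ ((i : Fin N) × Fin (m i))) :
    ‖Matrix.toEuclideanLin (blockMat m (selectBlocks a fun i j => (i : ℕ) + 1 = j)) x‖
      ≤ rU a * ‖x‖ :=
  norm_selectBlocks_le a _ (fun i j j' h h' => Fin.ext (by omega))
    (fun i i' j h h' => Fin.ext (by omega)) (rU_nonneg a) (fun _ _ => opNorm_le_rU a) x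

end Blocks

section Window

variable {N : ℕ} {m : Fin N → ℕ} {n k : ℕ}

/-- The inclusion of the scalar indices of a window into those of the full block matrix. -/
def windowEmb (m : Fin N → ℕ) (h : k + n ≤ N) (q : (j : Fin n) × Fin (m (widx h j))) :
    (i : Fin N) × Fin (m i) :=
  ⟨widx h q.1, q.2⟩

lemma windowEmb_injective (h : k + n ≤ N) : Function.Injective (windowEmb m h) := by
  rintro ⟨i, α⟩ ⟨j, β⟩ hij
  obtain rfl : i = j := by
    have := congrArg (fun p => (p.1 : ℕ)) hij
    simp only [windowEmb, widx] at this
    exact Fin.ext (by omega)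
  simpa [windowEmb] using hij

lemma mem_range_windowEmb (h : k + n ≤ N) {p : (i : Fin N) × Fin (m i)}
    (h₁ : k ≤ p.1) (h₂ : (p.1 : ℕ) < k + n) : p ∈ Set.range (windowEmb m h) := by
  obtain ⟨i, α⟩ := p
  obtain ⟨j, rfl⟩ : ∃ j : Fin n, widx h j = i :=
    ⟨⟨i - k, by simp only at h₁ h₂; omega⟩, Fin.ext (by simp only [widx] at h₁ ⊢; omega)⟩
  exact ⟨⟨j, α⟩, rfl⟩

lemma sum_windowEmb {M : Type*} [AddCommMonoid M] (h : k + n ≤ N)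
    {f : (i : Fin N) × Fin (m i) → M} (hf : ∀ p, p ∉ Set.range (windowEmb m h) → f p = 0) :
    ∑ q, f (windowEmb m h q) = ∑ p, f p :=
  Finset.sum_of_injOn _ (windowEmb_injective h).injOn (by simp)
    (fun p _ hp => hf p (by simpa using hp)) (fun _ _ => rfl)

variable (a : ∀ i j : Fin N, Matrix (Fin (m i)) (Fin (m j)) ℂ)

lemma sb_coe (i j : Fin N) (α : Fin (m i)) (β : Fin (m j)) :
    sb a (i : ℤ) (j : ℤ) α β = a i j α β := by
  simp [sb]

lemma sb_eq_zero_of_row {i : ℤ} (hi : ¬(0 ≤ i ∧ i < N)) (j : ℤ) (α β : ℕ) :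
    sb a i j α β = 0 := by
  simp [sb, hi]

lemma sb_eq_zero_of_far (htri : ∀ i j : Fin N, 1 < |(i : ℤ) - (j : ℤ)| → a i j = 0)
    {i j : ℤ} (hij : 1 < |i - j|) (α β : ℕ) : sb a i j α β = 0 := by
  unfold sb
  split_ifs with hi hj
  · rw [htri _ _ (by simpa [hi.1, hj.1] using hij)]
    rfl
  all_goals rfl

/-- For a block-tridiagonal matrix, `B^+_{n,k}` acts isometrically like the full matrix on vectors
supported in the window. -/
lemma norm_Bplus_windowEmb (htri : ∀ i j : Fin N, 1 < |(i : ℤ) - (j : ℤ)| → a i j = 0)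
    (h : k + n ≤ N) {y : EuclideanSpace ℂ ((i : Fin N) × Fin (m i))}
    (hy : ∀ p, p ∉ Set.range (windowEmb m h) → y p = 0) :
    ‖Matrix.toEuclideanLin (Bplus a n k h) (WithLp.toLp 2 fun q => y (windowEmb m h q))‖
      = ‖Matrix.toEuclideanLin (blockMat m a) y‖ := by
  set G : ℤ → ℕ → ℝ := fun i α =>
    ‖∑ q : (j : Fin n) × Fin (m (widx h j)),
      sb a i ((k : ℤ) + q.1) α q.2 * y (windowEmb m h q)‖ ^ 2 with hG
  set H : ℤ → ℝ := fun i => ∑ α ∈ Finset.range (rsz m i), G i α with hH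
  have hH_row : ∀ i : ℤ, ¬(0 ≤ i ∧ i < N) → H i = 0 := fun i hi => by
    simp [hH, hG, sb_eq_zero_of_row a hi]
  have hH_far : ∀ i : ℤ, ¬((k : ℤ) - 1 ≤ i ∧ i < (k : ℤ) + n + 1) → H i = 0 := fun i hi => by
    refine Finset.sum_eq_zero fun α _ => ?_
    simp only [hG]
    rw [Finset.sum_eq_zero fun q _ => ?_]
    · simp
    · have := q.1.isLt
      rw [sb_eq_zero_of_far a htri (by rw [lt_abs]; omega), zero_mul]
  have hleft : ‖Matrix.toEuclideanLin (Bplus a n k h)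
      (WithLp.toLp 2 fun q => y (windowEmb m h q))‖ ^ 2
      = ∑ i ∈ Finset.range (n + 2), H ((k : ℤ) - 1 + i) := by
    rw [norm_sq_toEuclideanLin, Fintype.sum_sigma, ← Fin.sum_univ_eq_sum_range]
    refine Finset.sum_congr rfl fun i _ => ?_
    rw [hH]
    simp only [← Fin.sum_univ_eq_sum_range]
    rfl
  have hright : ‖Matrix.toEuclideanLin (blockMat m a) y‖ ^ 2
      = ∑ i ∈ Finset.range N, H i := by
    rw [norm_sq_toEuclideanLin, Fintype.sum_sigma, ← Fin.sum_univ_eq_sum_range (fun i => H i)]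
    refine Finset.sum_congr rfl fun i _ => ?_
    have hsz : rsz m (i : ℤ) = m i := by simp [rsz]
    rw [hH]
    simp only [hsz, ← Fin.sum_univ_eq_sum_range (fun α => G i α)]
    refine Finset.sum_congr rfl fun α _ => ?_
    rw [← sum_windowEmb h fun p hp => by rw [hy p hp, mul_zero]]
    simp only [hG]
    congr! 4 with q
    have := sb_coe a i (widx h q.1) α q.2
    simpa [widx, blockMat, windowEmb] using this.symm
  refine (sq_eq_sq₀ (norm_nonneg _) (norm_nonneg _)).mp ?_
  rw [hleft, hright]
  trans ∑ i ∈ Finset.Icc (-1 : ℤ) N, H i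
  · refine Finset.sum_of_injOn (fun i : ℕ => (k : ℤ) - 1 + i) (fun i _ j _ hij => by
      simpa using hij) (fun i hi => ?_) (fun i hi hi' => ?_) (fun _ _ => rfl)
    · simp only [Finset.coe_range, Set.mem_Iio, Finset.coe_Icc, Set.mem_Icc] at *
      omega
    · refine hH_far i fun hc => hi' ⟨(i - (k - 1)).toNat, ?_, ?_⟩
      · simp only [Finset.coe_range, Set.mem_Iio]
        omega
      · simp only
        omega
  · refine (Finset.sum_of_injOn (fun i : ℕ => (i : ℤ)) (fun i _ j _ hij => by
      simpa using hij) (fun i hi => ?_) (fun i hi hi' => ?_) (fun _ _ => rfl)).symm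
    · simp only [Finset.coe_range, Set.mem_Iio, Finset.coe_Icc, Set.mem_Icc] at *
      omega
    · refine hH_row i fun hc => hi' ⟨i.toNat, ?_, ?_⟩
      · simp only [Finset.coe_range, Set.mem_Iio]
        omega
      · simp only
        omega

lemma norm_windowEmb (h : k + n ≤ N) {y : EuclideanSpace ℂ ((i : Fin N) × Fin (m i))}
    (hy : ∀ p, p ∉ Set.range (windowEmb m h) → y p = 0) :
    ‖(WithLp.toLp 2 fun q => y (windowEmb m h q) :
      EuclideanSpace ℂ ((j : Fin n) × Fin (m (widx h j))))‖ = ‖y‖ := by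
  refine (sq_eq_sq₀ (norm_nonneg _) (norm_nonneg _)).mp ?_
  rw [EuclideanSpace.norm_sq_eq, EuclideanSpace.norm_sq_eq]
  exact sum_windowEmb h (f := fun p => ‖y p‖ ^ 2) fun p hp => by simp [hy p hp]

lemma sval_blockMat_le_sval_Bplus
    (htri : ∀ i j : Fin N, 1 < |(i : ℤ) - (j : ℤ)| → a i j = 0) (hm : ∀ i, 0 < m i)
    (hn : 1 ≤ n) (h : k + n ≤ N) : sval (blockMat m a) ≤ sval (Bplus a n k h) := by
  have : Nonempty ((j : Fin n) × Fin (m (widx h j))) := ⟨⟨⟨0, hn⟩, ⟨0, hm _⟩⟩⟩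
  refine le_sval fun z hz => ?_
  set y : EuclideanSpace ℂ ((i : Fin N) × Fin (m i)) :=
    WithLp.toLp 2 (Function.extend (windowEmb m h) z 0) with hy
  have hsupp : ∀ p, p ∉ Set.range (windowEmb m h) → y p = 0 := fun p hp => by
    simp only [hy]
    exact Function.extend_apply' _ _ _ hp
  have hyz : (WithLp.toLp 2 fun q => y (windowEmb m h q)) = z := by
    ext q
    simp [hy, (windowEmb_injective h).extend_apply]
  rw [← hyz, norm_Bplus_windowEmb a htri h hsupp]
  apply sval_le_norm
  rw [← norm_windowEmb h hsupp, hyz, hz]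

end Window

section Weights

/-- The sine weights supported on the positions `1, …, n`. -/
def sineWeight (n : ℕ) (j : ℤ) : ℝ :=
  if 0 ≤ j ∧ j ≤ n + 1 then Real.sin (j * (π / (n + 1))) else 0

lemma sineWeight_eq_zero {n : ℕ} {j : ℤ} (hj : ¬(1 ≤ j ∧ j ≤ n)) : sineWeight n j = 0 := by
  unfold sineWeight
  split_ifs with h
  · rcases (by omega : j = 0 ∨ j = n + 1) with rfl | rfl
    · simp
    · push_cast
      rw [mul_div_cancel₀ _ (by positivity), Real.sin_pi]
  · rfl

lemma sineWeight_natCast {n t : ℕ} (ht : t ≤ n + 1) :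
    sineWeight n t = Real.sin (t * (π / (n + 1))) := by
  rw [sineWeight, if_pos (by omega)]
  simp

/-- The squared norm of the weight sequence. -/
def sineMass (n : ℕ) : ℝ := ∑ t ∈ Finset.range (n + 1), sineWeight n t ^ 2

lemma sineMass_pos {n : ℕ} (hn : 1 ≤ n) : 0 < sineMass n := by
  have hpos : 0 < sineWeight n (1 : ℕ) := by
    rw [sineWeight_natCast (by omega)]
    have : (1 : ℝ) ≤ n := by exact_mod_cast hn
    refine Real.sin_pos_of_pos_of_lt_pi (by positivity) ?_
    rw [Nat.cast_one, one_mul, div_lt_iff₀ (by positivity)]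
    nlinarith [Real.pi_pos]
  exact Finset.sum_pos' (fun _ _ => sq_nonneg _)
    ⟨1, Finset.mem_range.mpr (by omega), pow_pos hpos 2⟩

lemma sum_sq_sin_succ_sub (θ : ℝ) (L : ℕ) :
    ∑ t ∈ Finset.range L, (Real.sin ((t + 1 : ℕ) * θ) - Real.sin (t * θ)) ^ 2
      = (2 * Real.sin (θ / 2)) ^ 2 * ∑ t ∈ Finset.range L, Real.sin (t * θ) ^ 2
        + (Real.sin (L * θ) ^ 2 - Real.sin (L * θ) * Real.sin ((L - 1) * θ)) := by
  induction L with
  | zero => simp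
  | succ L ih =>
    rw [Finset.sum_range_succ, Finset.sum_range_succ, ih]
    have hcos : (2 * Real.sin (θ / 2)) ^ 2 = 2 - 2 * Real.cos θ := by
      rw [mul_pow, Real.sin_sq_eq_half_sub, mul_div_cancel₀ _ two_ne_zero]
      ring
    have h₁ : Real.sin ((L - 1) * θ)
        = Real.sin (L * θ) * Real.cos θ - Real.cos (L * θ) * Real.sin θ := by
      rw [sub_mul, one_mul, Real.sin_sub]
    have h₂ : Real.sin ((L + 1 : ℕ) * θ)
        = Real.sin (L * θ) * Real.cos θ + Real.cos (L * θ) * Real.sin θ := by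
      push_cast
      rw [add_mul, one_mul, Real.sin_add]
    have h₃ : (((L + 1 : ℕ) : ℝ) - 1) * θ = L * θ := by
      push_cast
      ring
    rw [hcos, h₁, h₂, h₃]
    ring

lemma sum_sq_sineWeight_succ_sub (n : ℕ) :
    ∑ t ∈ Finset.range (n + 1), (sineWeight n (t + 1 : ℕ) - sineWeight n t) ^ 2
      = (2 * Real.sin (π / (2 * n + 2))) ^ 2 * sineMass n := by
  have h := sum_sq_sin_succ_sub (π / (n + 1)) (n + 1)
  have hpi : ((n + 1 : ℕ) : ℝ) * (π / (n + 1)) = π := by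
    push_cast
    rw [mul_div_cancel₀ _ (by positivity)]
  have hhalf : π / ((n : ℝ) + 1) / 2 = π / (2 * n + 2) := by
    rw [div_div]
    congr 1
    ring
  rw [hpi, Real.sin_pi, hhalf] at h
  have hterm : ∀ t ∈ Finset.range (n + 1), (sineWeight n (t + 1 : ℕ) - sineWeight n t) ^ 2
      = (Real.sin ((t + 1 : ℕ) * (π / (n + 1))) - Real.sin (t * (π / (n + 1)))) ^ 2 := by
    intro t ht
    rw [Finset.mem_range] at ht
    rw [sineWeight_natCast (by omega), sineWeight_natCast (by omega)]
  have hmass : sineMass n = ∑ t ∈ Finset.range (n + 1), Real.sin (t * (π / (n + 1))) ^ 2 := by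
    refine Finset.sum_congr rfl fun t ht => ?_
    rw [Finset.mem_range] at ht
    rw [sineWeight_natCast (by omega)]
  rw [Finset.sum_congr rfl hterm, h, hmass]
  ring

lemma sum_sub_eq_sum_range {f : ℤ → ℝ} {c : ℤ} {L : ℕ} (hf : ∀ j, ¬(c ≤ j ∧ j < c + L) → f j = 0)
    {lo hi i : ℤ} (hlo : lo + c + L ≤ i + 1) (hhi : i ≤ hi + c) :
    ∑ k ∈ Finset.Icc lo hi, f (i - k) = ∑ t ∈ Finset.range L, f (c + t) := by
  refine (Finset.sum_of_injOn (fun t : ℕ => i - c - t) (fun t _ s _ hts => by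
    simpa using hts) (fun t ht => ?_) (fun k hk hk' => ?_) (fun t _ => ?_)).symm
  · simp only [Finset.coe_range, Set.mem_Iio, Finset.coe_Icc, Set.mem_Icc] at *
    omega
  · refine hf _ fun hc => hk' ⟨(i - c - k).toNat, ?_, ?_⟩
    · simp only [Finset.coe_range, Set.mem_Iio]
      omega
    · simp only
      omega
  · congr 1
    ring

variable {n : ℕ} {lo hi i : ℤ}

lemma sum_sq_sineWeight_sub (hlo : lo + n + 1 ≤ i) (hhi : i < hi) :
    ∑ k ∈ Finset.Icc lo hi, sineWeight n (i - k) ^ 2 = sineMass n := by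
  rw [sum_sub_eq_sum_range (f := fun j => sineWeight n j ^ 2) (c := 0) (L := n + 1) _
    (by push_cast; omega) (by omega)]
  · simp [sineMass]
  · intro j hj
    rw [sineWeight_eq_zero (by push_cast at hj; omega)]
    simp

lemma sum_sq_sineWeight_right (hlo : lo + n + 1 ≤ i) (hhi : i < hi) :
    ∑ k ∈ Finset.Icc lo hi, (sineWeight n (i + 1 - k) - sineWeight n (i - k)) ^ 2
      = (2 * Real.sin (π / (2 * n + 2))) ^ 2 * sineMass n := by
  rw [← sum_sq_sineWeight_succ_sub]
  have h := sum_sub_eq_sum_range (f := fun j => (sineWeight n (j + 1) - sineWeight n j) ^ 2)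
    (c := 0) (L := n + 1) (lo := lo) (hi := hi) (i := i) ?_ (by push_cast; omega) (by omega)
  · simpa [sub_add_eq_add_sub] using h
  · intro j hj
    rw [sineWeight_eq_zero (by push_cast at hj; omega), sineWeight_eq_zero (by
      push_cast at hj; omega)]
    simp

lemma sum_sq_sineWeight_left (hlo : lo + n + 1 ≤ i) (hhi : i < hi) :
    ∑ k ∈ Finset.Icc lo hi, (sineWeight n (i - 1 - k) - sineWeight n (i - k)) ^ 2
      = (2 * Real.sin (π / (2 * n + 2))) ^ 2 * sineMass n := by
  rw [← sum_sq_sineWeight_succ_sub]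
  have h := sum_sub_eq_sum_range (f := fun j => (sineWeight n (j - 1) - sineWeight n j) ^ 2)
    (c := 1) (L := n + 1) (lo := lo) (hi := hi) (i := i) ?_ (by push_cast; omega) (by omega)
  · simp only [sub_right_comm i 1] at h ⊢
    rw [h]
    refine Finset.sum_congr rfl fun t _ => ?_
    rw [sub_sq_comm]
    push_cast
    simp [add_comm]
  · intro j hj
    rw [sineWeight_eq_zero (by push_cast at hj; omega), sineWeight_eq_zero (by
      push_cast at hj; omega)]
    simp

end Weights

section Localization

variable {N : ℕ} {m : Fin N → ℕ}

/-- Multiplication of a block vector by weights depending only on the block index. -/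
def blockScale (c : ℤ → ℝ) (v : EuclideanSpace ℂ ((i : Fin N) × Fin (m i))) :
    EuclideanSpace ℂ ((i : Fin N) × Fin (m i)) :=
  WithLp.toLp 2 fun p => (c p.1 : ℂ) * v p

lemma sum_norm_sq_blockScale {K : Finset ℤ} {c : ℤ → ℤ → ℝ} {C : ℝ}
    (h : ∀ i : Fin N, ∑ k ∈ K, c k i ^ 2 = C)
    (v : EuclideanSpace ℂ ((i : Fin N) × Fin (m i))) :
    ∑ k ∈ K, ‖blockScale (c k) v‖ ^ 2 = C * ‖v‖ ^ 2 := by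
  simp only [EuclideanSpace.norm_sq_eq, blockScale, norm_mul, mul_pow, Complex.norm_real,
    Real.norm_eq_abs, sq_abs]
  rw [Finset.sum_comm, Finset.mul_sum]
  refine Finset.sum_congr rfl fun p _ => ?_
  rw [← Finset.sum_mul, h]

variable (a : ∀ i j : Fin N, Matrix (Fin (m i)) (Fin (m j)) ℂ)

/-- The commutator of a block-tridiagonal matrix with a blockwise weight. -/
lemma toEuclideanLin_blockScale
    (htri : ∀ i j : Fin N, 1 < |(i : ℤ) - (j : ℤ)| → a i j = 0) (c : ℤ → ℝ)
    (x : EuclideanSpace ℂ ((i : Fin N) × Fin (m i))) :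
    Matrix.toEuclideanLin (blockMat m a) (blockScale c x)
      = blockScale c (Matrix.toEuclideanLin (blockMat m a) x)
        + blockScale (fun i => c (i - 1) - c i) (Matrix.toEuclideanLin
          (blockMat m (selectBlocks a fun i j => (j : ℕ) + 1 = i)) x)
        + blockScale (fun i => c (i + 1) - c i) (Matrix.toEuclideanLin
          (blockMat m (selectBlocks a fun i j => (i : ℕ) + 1 = j)) x) := by
  ext p
  simp only [blockScale, PiLp.add_apply, toEuclideanLin_apply_eq_sum, Finset.mul_sum,
    ← Finset.sum_add_distrib]
  refine Finset.sum_congr rfl fun q _ => ?_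
  obtain ⟨i, α⟩ := p
  obtain ⟨j, β⟩ := q
  simp only [blockMat, selectBlocks]
  rcases lt_or_ge 1 |(i : ℤ) - (j : ℤ)| with hij | hij
  · simp [htri i j hij]
  · rw [abs_le] at hij
    rcases (by omega : (i : ℕ) = j ∨ (j : ℕ) + 1 = i ∨ (i : ℕ) + 1 = j) with h | h | h
    · rw [if_neg (by omega), if_neg (by omega), h]
      simp only [Matrix.zero_apply]
      ring
    · have hc : (i : ℤ) - 1 = j := by omega
      rw [if_pos h, if_neg (by omega), hc]
      simp only [Matrix.zero_apply]
      push_cast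
      ring
    · have hc : (i : ℤ) + 1 = j := by omega
      rw [if_neg (by omega), if_pos h, hc]
      simp only [Matrix.zero_apply]
      push_cast
      ring

/-- The Minkowski inequality in the form `(∑ ‖f + g + h‖²)^{1/2} ≤ F + G + H`. -/
lemma sum_norm_sq_add_add_le {E κ : Type*} [SeminormedAddCommGroup E] (K : Finset κ)
    {f g h : κ → E} {F G H : ℝ} (hF : 0 ≤ F) (hG : 0 ≤ G) (hH : 0 ≤ H)
    (hf : ∑ k ∈ K, ‖f k‖ ^ 2 ≤ F ^ 2) (hg : ∑ k ∈ K, ‖g k‖ ^ 2 ≤ G ^ 2)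
    (hh : ∑ k ∈ K, ‖h k‖ ^ 2 ≤ H ^ 2) :
    ∑ k ∈ K, ‖f k + g k + h k‖ ^ 2 ≤ (F + G + H) ^ 2 := by
  let T : (κ → E) → PiLp 2 fun _ : K => E := fun u => WithLp.toLp 2 fun k => u k
  have hT : ∀ u, ‖T u‖ ^ 2 = ∑ k ∈ K, ‖u k‖ ^ 2 := fun u => by
    rw [PiLp.norm_sq_eq_of_L2, ← Finset.sum_coe_sort K]
  have hle : ∀ {u : κ → E} {U : ℝ}, 0 ≤ U → ∑ k ∈ K, ‖u k‖ ^ 2 ≤ U ^ 2 → ‖T u‖ ≤ U :=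
    fun hU hu => le_of_sq_le_sq ((hT _).trans_le hu) hU
  rw [← hT fun k => f k + g k + h k]
  refine pow_le_pow_left₀ (norm_nonneg _) ?_ 2
  calc ‖T fun k => f k + g k + h k‖ = ‖T f + T g + T h‖ := rfl
    _ ≤ ‖T f‖ + ‖T g‖ + ‖T h‖ := norm_add₃_le
    _ ≤ F + G + H := add_le_add (add_le_add (hle hF hf) (hle hG hg)) (hle hH hh)

lemma mul_norm_blockScale_le
    (htri : ∀ i j : Fin N, 1 < |(i : ℤ) - (j : ℤ)| → a i j = 0) {n : ℕ} (hnN : n ≤ N)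
    {μ : ℝ} (hμ : ∀ (k : ℕ) (h : k + n ≤ N), μ ≤ sval (Bplus a n k h))
    (x : EuclideanSpace ℂ ((i : Fin N) × Fin (m i))) (k : ℤ) :
    μ * ‖blockScale (fun i => sineWeight n (i - k)) x‖
      ≤ ‖Matrix.toEuclideanLin (blockMat m a) (blockScale (fun i => sineWeight n (i - k)) x)‖ := by
  obtain ⟨k', hk', hsub⟩ : ∃ k' : ℕ, k' + n ≤ N ∧ ∀ i : ℕ, i < N → 1 ≤ (i : ℤ) - k →
      (i : ℤ) - k ≤ n → k' ≤ i ∧ i < k' + n :=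
    ⟨min (k + 1).toNat (N - n), by omega, fun i _ _ _ => by omega⟩
  have hsupp : ∀ p, p ∉ Set.range (windowEmb m hk') →
      blockScale (fun i => sineWeight n (i - k)) x p = 0 := by
    intro p hp
    simp only [blockScale]
    rw [sineWeight_eq_zero fun hc => hp ?_]
    · simp
    · obtain ⟨h₁, h₂⟩ := hsub p.1 p.1.isLt hc.1 hc.2
      exact mem_range_windowEmb hk' h₁ h₂
  rw [← norm_Bplus_windowEmb a htri hk' hsupp, ← norm_windowEmb hk' hsupp]
  exact (mul_le_mul_of_nonneg_right (hμ k' hk') (norm_nonneg _)).trans (sval_mul_norm_le _ _)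

lemma mul_norm_le_of_le_sval_Bplus
    (htri : ∀ i j : Fin N, 1 < |(i : ℤ) - (j : ℤ)| → a i j = 0) {n : ℕ} (hn : 1 ≤ n)
    (hnN : n ≤ N) {μ : ℝ} (hμ₀ : 0 ≤ μ)
    (hμ : ∀ (k : ℕ) (h : k + n ≤ N), μ ≤ sval (Bplus a n k h))
    (x : EuclideanSpace ℂ ((i : Fin N) × Fin (m i))) :
    μ * ‖x‖ ≤ ‖Matrix.toEuclideanLin (blockMat m a) x‖
      + 2 * rA a * Real.sin (π / (2 * n + 2)) * ‖x‖ := by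
  set δ := 2 * Real.sin (π / (2 * n + 2)) with hδ
  have hδ₀ : 0 ≤ δ := by
    refine mul_nonneg zero_le_two (Real.sin_nonneg_of_nonneg_of_le_pi (by positivity) ?_)
    exact div_le_self Real.pi_pos.le (by linarith [(n.cast_nonneg : (0 : ℝ) ≤ n)])
  obtain ⟨s, hs, hS⟩ : ∃ s : ℝ, 0 < s ∧ s ^ 2 = sineMass n :=
    ⟨√(sineMass n), Real.sqrt_pos.mpr (sineMass_pos hn), Real.sq_sqrt (sineMass_pos hn).le⟩
  set K := Finset.Icc (-(n + 1) : ℤ) N with hK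
  have hlo : ∀ i : Fin N, -(n + 1 : ℤ) + n + 1 ≤ i := fun i => by omega
  have hhi : ∀ i : Fin N, (i : ℤ) < N := fun i => by omega
  have hw := fun v => sum_norm_sq_blockScale (m := m) (K := K)
    (c := fun k i => sineWeight n (i - k)) (fun i => sum_sq_sineWeight_sub (hlo i) (hhi i)) v
  have hl := fun v => sum_norm_sq_blockScale (m := m) (K := K)
    (c := fun k i => sineWeight n (i - 1 - k) - sineWeight n (i - k))
    (fun i => sum_sq_sineWeight_left (hlo i) (hhi i)) v
  have hr := fun v => sum_norm_sq_blockScale (m := m) (K := K)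
    (c := fun k i => sineWeight n (i + 1 - k) - sineWeight n (i - k))
    (fun i => sum_sq_sineWeight_right (hlo i) (hhi i)) v
  rw [← hδ, ← hS, ← mul_pow] at hl hr
  have hL := norm_lower_le a x
  have hU := norm_upper_le a x
  have hupper := sum_norm_sq_add_add_le K
    (F := s * ‖Matrix.toEuclideanLin (blockMat m a) x‖)
    (G := δ * s * (rL a * ‖x‖)) (H := δ * s * (rU a * ‖x‖))
    (by positivity) (mul_nonneg (by positivity) ((norm_nonneg _).trans hL))
    (mul_nonneg (by positivity) ((norm_nonneg _).trans hU))
    (by rw [hw, ← hS, mul_pow])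
    (by rw [hl, mul_pow _ (rL a * _)]; gcongr)
    (by rw [hr, mul_pow _ (rU a * _)]; gcongr)
  have hlower : (μ * (s * ‖x‖)) ^ 2 ≤ ∑ k ∈ K, ‖Matrix.toEuclideanLin (blockMat m a)
      (blockScale (fun i => sineWeight n (i - k)) x)‖ ^ 2 := by
    rw [mul_pow, mul_pow s, hS, ← hw x, Finset.mul_sum]
    refine Finset.sum_le_sum fun k _ => ?_
    rw [← mul_pow]
    exact pow_le_pow_left₀ (by positivity) (mul_norm_blockScale_le a htri hnN hμ x k) 2
  simp only [toEuclideanLin_blockScale a htri] at hlower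
  have hfin := le_of_sq_le_sq (hlower.trans hupper) (by
    have := rL_nonneg a
    have := rU_nonneg a
    positivity)
  refine le_of_mul_le_mul_left ?_ hs
  calc s * (μ * ‖x‖) = μ * (s * ‖x‖) := by ring
    _ ≤ _ := hfin
    _ = _ := by rw [rA, hδ]; ring

end Localization

end SpecIncl

open SpecIncl in
/-- **Theorem 4.1 (one-sided truncations).** If A is block-tridiagonal (C = 0),
then for 1 ≤ n ≤ N−1:
`min_k ν(A^+_{n,k}) ≤ ν(A) + ε''_n(A) ≤ min_k ν(A^+_{n,k}) + ε''_n(A)`. -/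
theorem nu_one_sided_truncations {N : ℕ} (hN : 1 < N) {m : Fin N → ℕ}
    (hm : ∀ i, 0 < m i)
    (a : ∀ i j : Fin N, Matrix (Fin (m i)) (Fin (m j)) ℂ)
    (htri : ∀ i j : Fin N, 1 < |(i : ℤ) - (j : ℤ)| → a i j = 0)
    (n : ℕ) (hn : 1 ≤ n) (hnN : n ≤ N - 1) :
    (⨅ k : Fin (N - n + 1), sval (Bplus a n k (kwin (by omega) k)))
        ≤ sval (blockMat m a) + epsTau1 a n ∧
    sval (blockMat m a) + epsTau1 a n ≤
      (⨅ k : Fin (N - n + 1), sval (Bplus a n k (kwin (by omega) k))) + epsTau1 a n := by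
  have hnN' : n ≤ N := by omega
  have hbdd : BddBelow (Set.range fun k : Fin (N - n + 1) =>
      sval (Bplus a n k (kwin hnN' k))) := (Set.finite_range _).bddBelow
  have : Nonempty ((i : Fin N) × Fin (m i)) := ⟨⟨⟨0, by omega⟩, ⟨0, hm _⟩⟩⟩
  constructor
  · rw [← sub_le_iff_le_add]
    refine le_sval fun x hx => ?_
    have h := mul_norm_le_of_le_sval_Bplus a htri hn hnN'
      (Real.iInf_nonneg fun k : Fin (N - n + 1) => sval_nonneg (Bplus a n k (kwin hnN' k)))
      (fun k h => ciInf_le hbdd ⟨k, by omega⟩) x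
    rw [hx, mul_one, mul_one] at h
    have hC := opNorm_nonneg (blockMat m (remPart a))
    simp only [epsTau1]
    linarith
  · gcongr
    exact le_ciInf fun k => sval_blockMat_le_sval_Bplus a htri hm hn (kwin hnN' k)
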